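/- The Vietoris hyperspace ℱ(ℚ^ω) of all nonempty finite subsets of ℚ^ω is homeomorphic to ℚ^ω. -/

import Mathlib

open Set Topology Filter

/-- The Vietoris topology on `Set X` induced by a topology `t` on `X`, generated by the
subbasic sets `{F | F ⊆ U}` and `{F | F ∩ U ≠ ∅}` for `U` open in `t`. -/
def vietoris {X : Type*} (t : TopologicalSpace X) : TopologicalSpace (Set X) :=
  TopologicalSpace.generateFrom
    {S | (∃ U : Set X, IsOpen[t] U ∧ S = {F : Set X | F ⊆ U}) ∨
         (∃ U : Set X, IsOpen[t] U ∧ S = {F : Set X | (F ∩ U).Nonempty})}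

/-- `ℱ(X)`: the hyperspace of nonempty finite subsets of `X`. -/
def FinHyp (X : Type*) : Type _ := {F : Set X // F.Finite ∧ F.Nonempty}

noncomputable instance FinHyp.instCoeOut {X : Type*} : CoeOut (FinHyp X) (Set X) :=
  ⟨Subtype.val⟩

/-- `ℱ(X)` carries the (subspace) Vietoris topology. -/
instance FinHyp.instTopologicalSpace {X : Type*} [t : TopologicalSpace X] :
    TopologicalSpace (FinHyp X) :=
  (vietoris t).induced Subtype.val

section Partition

/-- A closed set together with a sequence of closed sets that accumulate only at it is closed. -/
theorem isClosed_union_iUnion_of_tendsto {E : Type*} [PseudoMetricSpace E] {G : Set E}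
    (hG : IsClosed G) {S : ℕ → Set E} (hS : ∀ i, IsClosed (S i)) {ρ : ℕ → ℝ}
    (hρ : Tendsto ρ atTop (𝓝 0)) (h : ∀ i, ∀ p ∈ S i, ∃ q ∈ G, dist p q < ρ i) :
    IsClosed (G ∪ ⋃ i, S i) := by
  rw [← isOpen_compl_iff, isOpen_iff_mem_nhds]
  intro p hp
  rw [mem_compl_iff, mem_union, not_or] at hp
  obtain ⟨r, hr, hrG⟩ := Metric.isOpen_iff.1 hG.isOpen_compl p hp.1
  obtain ⟨N, hN⟩ := eventually_atTop.1 (hρ.eventually_lt_const (half_pos hr))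
  have hfin : IsClosed (⋃ i ∈ Iio N, S i) := (finite_Iio N).isClosed_biUnion fun i _ => hS i
  have hpN : p ∈ (⋃ i ∈ Iio N, S i)ᶜ := fun hmem =>
    hp.2 (iUnion₂_subset_iUnion _ _ hmem)
  filter_upwards [Metric.ball_mem_nhds p (half_pos hr), hfin.isOpen_compl.mem_nhds hpN]
    with z hz hzN hzS
  rcases hzS with hzG | hzS
  · exact hrG (Metric.ball_subset_ball (half_le_self hr.le) hz) hzG
  · obtain ⟨i, hi⟩ := mem_iUnion.1 hzS
    rcases lt_or_ge i N with hiN | hiN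
    · exact hzN (mem_biUnion hiN hi)
    · obtain ⟨q, hqG, hq⟩ := h i z hi
      refine hrG ?_ hqG
      have h1 := hN i hiN
      have h2 := dist_triangle_left q p z
      rw [Metric.mem_ball] at hz ⊢
      linarith

variable {E : Type*} [MetricSpace E] [CompactSpace E] [TotallyDisconnectedSpace E]

/-- The complement of a closed nowhere dense set `A` in a clopen set `U` splits into a sequence of
small nonempty clopen sets which shrink towards `A` and accumulate at every point of `A`. -/
theorem exists_clopen_partition_diff {U A : Set E} (hU : IsClopen U) (hAU : A ⊆ U)
    (hA : IsClosed A) (hA' : interior A = ∅) (hne : A.Nonempty) {ε : ℝ} (hε : 0 < ε) :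
    ∃ (W : ℕ → Set E) (δ : ℕ → ℝ), (∀ i, IsClopen (W i)) ∧ (∀ i, (W i).Nonempty) ∧
      Pairwise (Function.onFun Disjoint W) ∧ ⋃ i, W i = U \ A ∧
      (∀ i, ∀ x ∈ W i, ∀ y ∈ W i, dist x y ≤ ε) ∧ Tendsto δ atTop (𝓝 0) ∧ (∀ i, 0 < δ i) ∧
      (∀ i, ∃ a ∈ A, W i ⊆ Metric.ball a (δ i)) ∧
      (∀ a ∈ A, ∀ r > 0, ∃ᶠ i in atTop, W i ⊆ Metric.ball a r) := by
  have hO : IsOpen (U \ A) := hU.isOpen.sdiff hA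
  have hpos : ∀ x ∈ U \ A, 0 < Metric.infDist x A := fun x hx =>
    (hA.notMem_iff_infDist_pos hne).1 hx.2
  have hclop : ∀ x : E, ∃ B : Set E, IsClopen B ∧ (x ∈ U \ A → x ∈ B) ∧ B ⊆ U \ A ∧
      ∀ y ∈ B, ∀ z ∈ B, dist y z ≤ ε ∧ dist y z ≤ Metric.infDist y A := by
    intro x
    by_cases hx : x ∈ U \ A
    · have hm : 0 < min (ε / 2) (Metric.infDist x A / 4) :=
        lt_min (half_pos hε) (by linarith [hpos x hx])
      obtain ⟨B, hB, hxB, hBs⟩ := compact_exists_isClopen_in_isOpen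
        (hO.inter (Metric.isOpen_ball (x := x) (ε := min (ε / 2) (Metric.infDist x A / 4))))
        ⟨hx, Metric.mem_ball_self hm⟩
      refine ⟨B, hB, fun _ => hxB, hBs.trans inter_subset_left, fun y hy z hz => ?_⟩
      have h1 := Metric.mem_ball.1 (hBs hy).2
      have h2 := Metric.mem_ball.1 (hBs hz).2
      have h3 := dist_triangle_right y z x
      have h4 : Metric.infDist x A ≤ Metric.infDist y A + dist x y :=
        Metric.infDist_le_infDist_add_dist
      rw [dist_comm] at h4
      have h5 := min_le_left (ε / 2) (Metric.infDist x A / 4)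
      have h6 := min_le_right (ε / 2) (Metric.infDist x A / 4)
      constructor <;> linarith
    · exact ⟨∅, isClopen_empty, fun h => absurd h hx, empty_subset _, by simp⟩
  choose B hB hxB hBO hBd using hclop
  obtain ⟨T, hTO, hTc, hT⟩ := TopologicalSpace.countable_cover_nhdsWithin
    (s := U \ A) (f := B) fun x hx =>
      mem_nhdsWithin_of_mem_nhds ((hB x).isOpen.mem_nhds (hxB x hx))
  have hOne : (U \ A).Nonempty := by
    rw [nonempty_iff_ne_empty, Ne, sdiff_eq_empty]
    intro h
    have : A = U := hAU.antisymm h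
    rw [this, hU.isOpen.interior_eq] at hA'
    rw [this, hA'] at hne
    exact not_nonempty_empty hne
  have hTne : T.Nonempty := by
    obtain ⟨x, hx⟩ := hOne
    obtain ⟨t, ht, -⟩ := mem_iUnion₂.1 (hT hx)
    exact ⟨t, ht⟩
  obtain ⟨t, rfl⟩ := hTc.exists_eq_range hTne
  let W₀ : ℕ → Set E := disjointed fun n => B (t n)
  have hW₀sub : ∀ n, W₀ n ⊆ B (t n) := fun n => disjointed_subset _ n
  have hW₀U : ⋃ n, W₀ n = U \ A := by
    rw [iUnion_disjointed]
    refine (iUnion_subset fun n => hBO _).antisymm ?_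
    simpa using hT
  have hW₀clop : ∀ n, IsClopen (W₀ n) := fun n =>
    disjointedRec (p := IsClopen) (fun _ _ h => h.diff (hB _)) (hB _)
  let I : Set ℕ := {n | (W₀ n).Nonempty}
  have hIU : ⋃ n ∈ I, W₀ n = U \ A := by
    rw [← hW₀U]
    refine (iUnion₂_subset_iUnion _ _).antisymm (iUnion_subset fun n x hx => ?_)
    exact mem_biUnion (show n ∈ I from ⟨x, hx⟩) hx
  have hI : I.Infinite := by
    intro hfin
    have hcl : IsClosed (U \ A) := by
      rw [← hIU]
      exact hfin.isClosed_biUnion fun n _ => (hW₀clop n).isClosed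
    have hAo : IsOpen A := by
      rw [← sdiff_sdiff_cancel_left hAU]
      exact hU.isOpen.sdiff hcl
    rw [hAo.interior_eq] at hA'
    exact hne.ne_empty hA'
  have := hI.to_subtype
  let e : ℕ → ℕ := fun i => Nat.Subtype.orderIsoOfNat I i
  have he : Function.Injective e :=
    Subtype.val_injective.comp (Nat.Subtype.orderIsoOfNat I).injective
  have heI : ∀ i, e i ∈ I := fun i => (Nat.Subtype.orderIsoOfNat I i).2
  have heU : ⋃ i, W₀ (e i) = U \ A := by
    rw [← hIU]
    refine (iUnion_subset fun i => subset_biUnion_of_mem (u := W₀) (heI i)).antisymm ?_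
    refine iUnion₂_subset fun n hn => ?_
    obtain ⟨i, hi⟩ := (Nat.Subtype.orderIsoOfNat I).surjective ⟨n, hn⟩
    have : e i = n := congrArg Subtype.val hi
    exact this ▸ subset_iUnion (fun i => W₀ (e i)) i
  have hdist : ∀ i, ∀ y ∈ W₀ (e i), ∀ z ∈ W₀ (e i),
      dist y z ≤ ε ∧ dist y z ≤ Metric.infDist y A := fun i y hy z hz =>
    hBd _ y (hW₀sub _ hy) z (hW₀sub _ hz)
  have hsub : ∀ i, W₀ (e i) ⊆ U \ A := fun i => heU ▸ subset_iUnion (fun i => W₀ (e i)) i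
  have hdisj : Pairwise (Function.onFun Disjoint fun i => W₀ (e i)) :=
    (disjoint_disjointed _).comp_of_injective he
  choose x hx using fun i => (heI i : (W₀ (e i)).Nonempty)
  refine ⟨fun i => W₀ (e i), fun i => 3 * Metric.infDist (x i) A, fun i => hW₀clop _, heI, hdisj,
    heU, fun i y hy z hz => (hdist i y hy z hz).1, ?_, ?_, ?_, ?_⟩
  · rw [← mul_zero (3 : ℝ)]
    refine Tendsto.const_mul _ (tendsto_order.2 ⟨fun r hr => Eventually.of_forall fun i =>
      hr.trans_le Metric.infDist_nonneg, fun r hr => ?_⟩)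
    have hFc : IsCompact (U ∩ {y | r ≤ Metric.infDist y A}) :=
      (hU.isClosed.inter (isClosed_le continuous_const
        (Metric.continuous_infDist_pt A))).isCompact
    obtain ⟨s, hs⟩ := hFc.elim_finite_subcover _ (fun i => (hW₀clop (e i)).isOpen) (by
      rw [heU]
      rintro y ⟨hyU, hy⟩
      refine ⟨hyU, fun hyA => ?_⟩
      rw [mem_ofPred_eq, Metric.infDist_zero_of_mem hyA] at hy
      exact hr.not_ge hy)
    rw [← Nat.cofinite_eq_atTop]
    filter_upwards [s.finite_toSet.compl_mem_cofinite] with i hi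
    by_contra! hlt
    obtain ⟨j, hj, hjx⟩ := mem_iUnion₂.1 (hs ⟨(hsub i (hx i)).1, hlt⟩)
    have : j ≠ i := fun h => hi (h ▸ hj)
    exact disjoint_left.1 (hdisj this) hjx (hx i)
  · exact fun i => mul_pos three_pos (hpos _ (hsub i (hx i)))
  · intro i
    obtain ⟨a, ha, hax⟩ := hA.isCompact.exists_infDist_eq_dist hne (x i)
    refine ⟨a, ha, fun y hy => Metric.mem_ball.2 ?_⟩
    have h1 := (hdist i (x i) (hx i) y hy).2
    have h2 := dist_triangle_left y a (x i)
    have h3 := hpos _ (hsub i (hx i))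
    linarith
  · intro a ha r hr
    rw [frequently_atTop]
    intro N
    have hcl : IsClosed (⋃ i ∈ Iio N, W₀ (e i)) :=
      (finite_Iio N).isClosed_biUnion fun i _ => (hW₀clop _).isClosed
    have hG : IsOpen ((Metric.ball a (r / 2) ∩ U) \ ⋃ i ∈ Iio N, W₀ (e i)) :=
      (Metric.isOpen_ball.inter hU.isOpen).sdiff hcl
    have haG : a ∈ (Metric.ball a (r / 2) ∩ U) \ ⋃ i ∈ Iio N, W₀ (e i) := by
      refine ⟨⟨Metric.mem_ball_self (half_pos hr), hAU ha⟩, fun hmem => ?_⟩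
      obtain ⟨i, -, hi⟩ := mem_iUnion₂.1 hmem
      exact (hsub i hi).2 ha
    have hnot : ¬ ((Metric.ball a (r / 2) ∩ U) \ ⋃ i ∈ Iio N, W₀ (e i)) ⊆ A := fun h => by
      have := interior_maximal h hG haG
      rw [hA'] at this
      exact this
    obtain ⟨y, ⟨⟨hyr, hyU⟩, hyN⟩, hyA⟩ := not_subset.1 hnot
    obtain ⟨i, hi⟩ := mem_iUnion.1 (heU.ge ⟨hyU, hyA⟩)
    refine ⟨i, le_of_not_gt fun hlt => hyN (mem_biUnion hlt hi), fun z hz => ?_⟩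
    have h1 := (hdist i y hi z hz).2
    have h2 := Metric.infDist_le_dist_of_mem ha (x := y)
    have h3 := dist_triangle_left z a y
    rw [Metric.mem_ball] at hyr ⊢
    linarith

end Partition

section Matching

variable {C D : Type*}

/-- The relation `R` is, at `(x, y)`, the graph of a bijection that respects `X` and `Y`. -/
def IsExactAt (X : Set C) (Y : Set D) (R : Set (C × D)) (x : C) (y : D) : Prop :=
  (∀ y', (x, y') ∈ R → y' = y) ∧ (∀ x', (x', y) ∈ R → x' = x) ∧ (x ∈ X ↔ y ∈ Y)

theorem IsExactAt.mono {X : Set C} {Y : Set D} {R R' : Set (C × D)} {x : C} {y : D}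
    (h : IsExactAt X Y R x y) (hR : R' ⊆ R) : IsExactAt X Y R' x y :=
  ⟨fun y' hy' => h.1 y' (hR hy'), fun x' hx' => h.2.1 x' (hR hx'), h.2.2⟩

theorem isExactAt_swap {X : Set C} {Y : Set D} {R : Set (C × D)} {x : C} {y : D} :
    IsExactAt Y X (Prod.swap ⁻¹' R) y x ↔ IsExactAt X Y R x y :=
  ⟨fun h => ⟨h.2.1, h.1, h.2.2.symm⟩, fun h => ⟨h.2.1, h.1, h.2.2.symm⟩⟩

variable [TopologicalSpace C] [TopologicalSpace D]

/-- `U ×ˢ V` is a nonempty clopen rectangle which is a connected component of the bipartite graph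
`R`. -/
structure IsBox (R : Set (C × D)) (U : Set C) (V : Set D) : Prop where
  isClopen_left : IsClopen U
  isClopen_right : IsClopen V
  nonempty_left : U.Nonempty
  nonempty_right : V.Nonempty
  mem_iff : ∀ x y, x ∈ U ∨ y ∈ V → ((x, y) ∈ R ↔ x ∈ U ∧ y ∈ V)

theorem IsBox.swap {R : Set (C × D)} {U : Set C} {V : Set D} (h : IsBox R U V) :
    IsBox (Prod.swap ⁻¹' R) V U :=
  ⟨h.2, h.1, h.4, h.3, fun x y hxy => (h.5 y x hxy.symm).trans and_comm⟩

theorem IsBox.eq_of_mem {R : Set (C × D)} {U U' : Set C} {V V' : Set D} (h : IsBox R U V)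
    (h' : IsBox R U' V') {x : C} {y : D} (hx : x ∈ U) (hy : y ∈ V) (hx' : x ∈ U') (hy' : y ∈ V') :
    U = U' ∧ V = V' := by
  constructor
  · ext z
    have h1 := h.mem_iff z y (.inr hy)
    have h2 := h'.mem_iff z y (.inr hy')
    tauto
  · ext z
    have h1 := h.mem_iff x z (.inl hx)
    have h2 := h'.mem_iff x z (.inl hx')
    tauto

/-- A closed relation between `U` and `V` which is an approximation of a homeomorphism: it is
made up of the graph of a partial bijection that respects `X` and `Y`, and of clopen rectangles. -/
structure IsMatching (X : Set C) (Y : Set D) (U : Set C) (V : Set D) (R : Set (C × D)) : Prop where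
  subset : R ⊆ U ×ˢ V
  isClosed : IsClosed R
  left : ∀ x ∈ U, ∃ y, (x, y) ∈ R
  right : ∀ y ∈ V, ∃ x, (x, y) ∈ R
  exact_or_box : ∀ x y, (x, y) ∈ R →
    IsExactAt X Y R x y ∨ ∃ U V, IsBox R U V ∧ x ∈ U ∧ y ∈ V

theorem IsMatching.swap {X : Set C} {Y : Set D} {U : Set C} {V : Set D} {R : Set (C × D)}
    (h : IsMatching X Y U V R) : IsMatching Y X V U (Prod.swap ⁻¹' R) where
  subset := fun _ hp => ⟨(h.subset hp).2, (h.subset hp).1⟩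
  isClosed := h.isClosed.preimage continuous_swap
  left := h.right
  right := h.left
  exact_or_box := fun y x hyx => (h.exact_or_box x y hyx).imp isExactAt_swap.2
    fun ⟨U', V', hb, hx, hy⟩ => ⟨V', U', hb.swap, hy, hx⟩

/-- Refining a matching inside each of its boxes. -/
theorem IsMatching.refine {X : Set C} {Y : Set D} {U : Set C} {V : Set D} {R : Set (C × D)}
    (h : IsMatching X Y U V R) (P : Set (C × D) → Prop)
    (hP : ∀ U V, IsClopen U → IsClopen V → U.Nonempty → V.Nonempty →
      ∃ S, IsMatching X Y U V S ∧ P S) :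
    ∃ R' ⊆ R, IsMatching X Y U V R' ∧ ∀ x y, (x, y) ∈ R' → IsExactAt X Y R' x y ∨
      ∃ S, P S ∧ (x, y) ∈ S ∧ (∀ y', (x, y') ∈ R' → (x, y') ∈ S) ∧
        (∀ x', (x', y) ∈ R' → (x', y) ∈ S) := by
  have hS : ∀ p : Set C × Set D, ∃ S, IsBox R p.1 p.2 → IsMatching X Y p.1 p.2 S ∧ P S := by
    intro p
    by_cases hp : IsBox R p.1 p.2
    · obtain ⟨S, hS⟩ := hP p.1 p.2 hp.1 hp.2 hp.3 hp.4
      exact ⟨S, fun _ => hS⟩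
    · exact ⟨∅, fun h => absurd h hp⟩
  choose S hS hSP using hS
  let R' : Set (C × D) := {z ∈ R | ∀ p : Set C × Set D, IsBox R p.1 p.2 → z ∈ p.1 ×ˢ p.2 → z ∈ S p}
  have hR' : R' ⊆ R := fun z hz => hz.1
  have hmem : ∀ p : Set C × Set D, IsBox R p.1 p.2 → ∀ z ∈ S p, z ∈ R' := by
    intro p hp z hz
    have hzp := (hS p hp).subset hz
    refine ⟨(hp.mem_iff z.1 z.2 (.inl hzp.1)).2 hzp, fun q hq hzq => ?_⟩
    obtain ⟨h1, h2⟩ := hp.eq_of_mem hq hzp.1 hzp.2 hzq.1 hzq.2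
    rwa [← Prod.ext h1 h2]
  have hleft : ∀ p : Set C × Set D, IsBox R p.1 p.2 → ∀ x y, x ∈ p.1 → (x, y) ∈ R' →
      (x, y) ∈ S p := fun p hp x y hx hxy =>
    hxy.2 p hp ((hp.mem_iff x y (.inl hx)).1 hxy.1)
  have hright : ∀ p : Set C × Set D, IsBox R p.1 p.2 → ∀ x y, y ∈ p.2 → (x, y) ∈ R' →
      (x, y) ∈ S p := fun p hp x y hy hxy =>
    hxy.2 p hp ((hp.mem_iff x y (.inr hy)).1 hxy.1)
  refine ⟨R', hR', ⟨hR'.trans h.subset, ?_, ?_, ?_, ?_⟩, ?_⟩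
  · have : R' = R ∩ ⋂ (p : Set C × Set D) (_ : IsBox R p.1 p.2), ((p.1 ×ˢ p.2)ᶜ ∪ S p) := by
      ext z
      simp only [R', mem_ofPred_eq, mem_inter_iff, mem_iInter, mem_union, mem_compl_iff,
        imp_iff_not_or]
    rw [this]
    exact h.isClosed.inter <| isClosed_iInter fun p => isClosed_iInter fun hp =>
      (hp.1.isOpen.prod hp.2.isOpen).isClosed_compl.union (hS p hp).isClosed
  · intro x hx
    obtain ⟨y, hxy⟩ := h.left x hx
    by_cases hb : ∃ p : Set C × Set D, IsBox R p.1 p.2 ∧ (x, y) ∈ p.1 ×ˢ p.2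
    · obtain ⟨p, hp, hxp, -⟩ := hb
      obtain ⟨y', hy'⟩ := (hS p hp).left x hxp
      exact ⟨y', hmem p hp _ hy'⟩
    · exact ⟨y, hxy, fun p hp hz => absurd ⟨p, hp, hz⟩ hb⟩
  · intro y hy
    obtain ⟨x, hxy⟩ := h.right y hy
    by_cases hb : ∃ p : Set C × Set D, IsBox R p.1 p.2 ∧ (x, y) ∈ p.1 ×ˢ p.2
    · obtain ⟨p, hp, -, hyp⟩ := hb
      obtain ⟨x', hx'⟩ := (hS p hp).right y hyp
      exact ⟨x', hmem p hp _ hx'⟩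
    · exact ⟨x, hxy, fun p hp hz => absurd ⟨p, hp, hz⟩ hb⟩
  · intro x y hxy
    rcases h.exact_or_box x y hxy.1 with hex | ⟨U', V', hb, hx, hy⟩
    · exact .inl (hex.mono hR')
    · have hxyS := hleft (U', V') hb x y hx hxy
      rcases (hS (U', V') hb).exact_or_box x y hxyS with hex | ⟨U₂, V₂, hb₂, hx₂, hy₂⟩
      · exact .inl ⟨fun y' hy' => hex.1 y' (hleft (U', V') hb x y' hx hy'),
          fun x' hx' => hex.2.1 x' (hright (U', V') hb x' y hy hx'), hex.2.2⟩
      · refine .inr ⟨U₂, V₂, ⟨hb₂.1, hb₂.2, hb₂.3, hb₂.4, fun x' y' hxy' => ?_⟩, hx₂, hy₂⟩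
        rw [← hb₂.mem_iff x' y' hxy']
        refine ⟨fun hz => ?_, hmem (U', V') hb _⟩
        rcases hxy' with hx' | hy'
        · have := (hS (U', V') hb).subset ((hb₂.mem_iff x' y (.inl hx')).2 ⟨hx', hy₂⟩)
          exact hleft (U', V') hb x' y' this.1 hz
        · have := (hS (U', V') hb).subset ((hb₂.mem_iff x y' (.inr hy')).2 ⟨hx₂, hy'⟩)
          exact hright (U', V') hb x' y' this.2 hz
  · intro x y hxy
    rcases h.exact_or_box x y hxy.1 with hex | ⟨U', V', hb, hx, hy⟩
    · exact .inl (hex.mono hR')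
    · exact .inr ⟨S (U', V'), hSP (U', V') hb, hleft (U', V') hb x y hx hxy,
        fun y' hy' => hleft (U', V') hb x y' hx hy',
        fun x' hx' => hright (U', V') hb x' y hy hx'⟩

end Matching

section Uniqueness

/-- A continuous injection of `C` onto a nowhere dense subset of `V` that reduces `X` to `Y`. -/
def HasNowhereDenseReduction {C D : Type*} [TopologicalSpace C] [TopologicalSpace D]
    (X : Set C) (Y : Set D) (V : Set D) : Prop :=
  ∃ g : C → D, Continuous g ∧ Function.Injective g ∧ range g ⊆ V ∧ interior (range g) = ∅ ∧
    ∀ x, x ∈ X ↔ g x ∈ Y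

variable {C D : Type*} [MetricSpace C] [CompactSpace C] [TotallyDisconnectedSpace C]
  [MetricSpace D] [CompactSpace D] [TotallyDisconnectedSpace D] {X : Set C} {Y : Set D}

/-- A Knaster–Reichbach cover: the restriction of `g` to `A` extends to a matching of `U` and `V`
by pairing small clopen pieces of `U \ A` and `V \ g '' A`. -/
theorem exists_isMatching_extending {U A : Set C} {V : Set D} (hU : IsClopen U) (hV : IsClopen V)
    (hAU : A ⊆ U) (hA : IsClosed A) (hA' : interior A = ∅) (hne : A.Nonempty)
    {g : C → D} (hg : Continuous g) (hinj : Function.Injective g) (hgV : range g ⊆ V)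
    (hg' : interior (range g) = ∅) (hXY : ∀ x, x ∈ X ↔ g x ∈ Y) {ε : ℝ} (hε : 0 < ε) :
    ∃ S, IsMatching X Y U V S ∧ (∀ x y y', (x, y) ∈ S → (x, y') ∈ S → dist y y' ≤ ε) ∧
      (∀ x x' y, (x, y) ∈ S → (x', y) ∈ S → dist x x' ≤ ε) ∧
      ∀ x ∈ A, ∀ y, (x, y) ∈ S → IsExactAt X Y S x y := by
  have hBV : g '' A ⊆ V := (image_subset_range g A).trans hgV
  obtain ⟨W, δ, hW, hWne, hWd, hWU, hWε, hδ, hδ0, hWδ, hWf⟩ :=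
    exists_clopen_partition_diff hU hAU hA hA' hne hε
  obtain ⟨Z, η, hZ, hZne, hZd, hZV, hZε, hη, hη0, hZη, hZf⟩ :=
    exists_clopen_partition_diff hV hBV (hA.isCompact.image hg).isClosed
      (subset_empty_iff.1 <| (interior_mono (image_subset_range g A)).trans hg'.subset)
      (hne.image g) hε
  choose a haA ha using hWδ
  choose b hbB hb using hZη
  choose c hcA hc using hbB
  obtain ⟨f₁, hf₁, hf₁'⟩ := extraction_forall_of_frequently fun i =>
    hZf (g (a i)) (mem_image_of_mem g (haA i)) (δ i) (hδ0 i)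
  obtain ⟨f₂, hf₂, hf₂'⟩ := extraction_forall_of_frequently fun k =>
    hWf (c k) (hcA k) (η k) (hη0 k)
  obtain ⟨π, hπ, hπR⟩ := Function.Embedding.schroeder_bernstein_of_rel hf₁.injective hf₂.injective
    (fun i k => ∃ a ∈ A, W i ⊆ Metric.ball a (δ i + η k) ∧ Z k ⊆ Metric.ball (g a) (δ i + η k))
    (fun i => ⟨a i, haA i,
      (ha i).trans (Metric.ball_subset_ball (le_add_of_nonneg_right (hη0 _).le)),
      (hf₁' i).trans (Metric.ball_subset_ball (le_add_of_nonneg_right (hη0 _).le))⟩)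
    (fun k => ⟨c k, hcA k,
      (hf₂' k).trans (Metric.ball_subset_ball (le_add_of_nonneg_left (hδ0 _).le)),
      hc k ▸ (hb k).trans (Metric.ball_subset_ball (le_add_of_nonneg_left (hδ0 _).le))⟩)
  have hWsub : ∀ i, W i ⊆ U \ A := fun i => hWU ▸ subset_iUnion W i
  have hZsub : ∀ i, Z i ⊆ V \ g '' A := fun i => hZV ▸ subset_iUnion Z i
  let G : Set (C × D) := (fun x => (x, g x)) '' A
  let S : Set (C × D) := G ∪ ⋃ i, W i ×ˢ Z (π i)
  have hSA : ∀ x ∈ A, ∀ y, (x, y) ∈ S → y = g x := by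
    rintro x hx y (⟨x', -, h⟩ | h)
    · rw [Prod.mk.injEq] at h
      rw [← h.2, h.1]
    · obtain ⟨i, hi⟩ := mem_iUnion.1 h
      exact absurd hx (hWsub i hi.1).2
  have hSB : ∀ x' ∈ A, ∀ x, (x, g x') ∈ S → x = x' := by
    rintro x' hx' x (⟨x'', -, h⟩ | h)
    · rw [Prod.mk.injEq] at h
      rw [← h.1, hinj h.2]
    · obtain ⟨i, hi⟩ := mem_iUnion.1 h
      exact absurd (mem_image_of_mem g hx') (hZsub _ hi.2).2
  have hexact : ∀ x ∈ A, ∀ y, (x, y) ∈ S → IsExactAt X Y S x y := by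
    intro x hx y hy
    obtain rfl := hSA x hx y hy
    exact ⟨fun y' => hSA x hx y', fun x' => hSB x hx x', hXY x⟩
  have hSW : ∀ i, ∀ x ∈ W i, ∀ y, (x, y) ∈ S → y ∈ Z (π i) := by
    rintro i x hx y (⟨x', hx', h⟩ | h)
    · rw [Prod.mk.injEq] at h
      exact absurd (h.1 ▸ hx') (hWsub i hx).2
    · obtain ⟨j, hj⟩ := mem_iUnion.1 h
      have : i = j := by
        by_contra hij
        exact disjoint_left.1 (hWd hij) hx hj.1
      exact this ▸ hj.2
  have hSZ : ∀ i, ∀ y ∈ Z (π i), ∀ x, (x, y) ∈ S → x ∈ W i := by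
    rintro i y hy x (⟨x', hx', h⟩ | h)
    · rw [Prod.mk.injEq] at h
      exact absurd (h.2 ▸ mem_image_of_mem g hx') (hZsub _ hy).2
    · obtain ⟨j, hj⟩ := mem_iUnion.1 h
      have : i = j := by
        by_contra hij
        exact disjoint_left.1 (hZd (hπ.1.ne hij)) hy hj.2
      exact this ▸ hj.1
  have hcases : ∀ x y, (x, y) ∈ S → x ∈ A ∨ ∃ i, x ∈ W i ∧ y ∈ Z (π i) := by
    rintro x y (⟨x', hx', h⟩ | h)
    · rw [Prod.mk.injEq] at h
      exact .inl (h.1 ▸ hx')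
    · obtain ⟨j, hj⟩ := mem_iUnion.1 h
      exact .inr ⟨j, hj⟩
  have hmem : ∀ i, W i ×ˢ Z (π i) ⊆ S := fun i =>
    (subset_iUnion (fun i => W i ×ˢ Z (π i)) i).trans subset_union_right
  refine ⟨S, ⟨?_, ?_, ?_, ?_, ?_⟩, ?_, ?_, hexact⟩
  · refine union_subset ?_ (iUnion_subset fun i => prod_mono ?_ ?_)
    · rintro _ ⟨x, hx, rfl⟩
      exact ⟨hAU hx, hgV (mem_range_self x)⟩
    · exact (hWsub i).trans sdiff_subset
    · exact (hZsub _).trans sdiff_subset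
  · refine isClosed_union_iUnion_of_tendsto (ρ := fun i => δ i + η (π i))
      (hA.isCompact.image (by fun_prop)).isClosed
      (fun i => (hW i).isClosed.prod (hZ _).isClosed) ?_ ?_
    · rw [← add_zero (0 : ℝ)]
      refine hδ.add (hη.comp ?_)
      rw [← Nat.cofinite_eq_atTop]
      exact hπ.1.tendsto_cofinite
    · rintro i ⟨x, y⟩ ⟨hx, hy⟩
      obtain ⟨a', ha', h1, h2⟩ := hπR i
      exact ⟨(a', g a'), mem_image_of_mem _ ha', max_lt (h1 hx) (h2 hy)⟩
  · intro x hx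
    by_cases hxA : x ∈ A
    · exact ⟨g x, .inl (mem_image_of_mem _ hxA)⟩
    · obtain ⟨i, hi⟩ := mem_iUnion.1 (hWU.ge ⟨hx, hxA⟩)
      obtain ⟨y, hy⟩ := hZne (π i)
      exact ⟨y, hmem i ⟨hi, hy⟩⟩
  · intro y hy
    by_cases hyB : y ∈ g '' A
    · obtain ⟨x, hx, rfl⟩ := hyB
      exact ⟨x, .inl (mem_image_of_mem _ hx)⟩
    · obtain ⟨k, hk⟩ := mem_iUnion.1 (hZV.ge ⟨hy, hyB⟩)
      obtain ⟨i, rfl⟩ := hπ.2 k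
      obtain ⟨x, hx⟩ := hWne i
      exact ⟨x, hmem i ⟨hx, hk⟩⟩
  · intro x y hxy
    rcases hcases x y hxy with hx | ⟨i, hx, hy⟩
    · exact .inl (hexact x hx y hxy)
    · refine .inr ⟨W i, Z (π i), ⟨hW i, hZ _, hWne i, hZne _, fun x' y' h => ⟨fun h' => ?_,
        fun h' => hmem i h'⟩⟩, hx, hy⟩
      rcases h with h | h
      · exact ⟨h, hSW i x' h y' h'⟩
      · exact ⟨hSZ i y' h x' h', h⟩
  · intro x y y' hy hy'
    rcases hcases x y hy with hx | ⟨i, hx, -⟩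
    · rw [hSA x hx y hy, hSA x hx y' hy', dist_self]
      exact hε.le
    · exact hZε (π i) y (hSW i x hx y hy) y' (hSW i x hx y' hy')
  · intro x x' y hx hx'
    rcases hcases x y hx with hxA | ⟨i, -, hy⟩
    · obtain rfl := hSA x hxA y hx
      rw [hSB x hxA x' hx', dist_self]
      exact hε.le
    · exact hWε i x (hSZ i y hy x hx) x' (hSZ i y hy x' hx')

theorem IsMatching.refine_left
    (hCD : ∀ V : Set D, IsClopen V → V.Nonempty → HasNowhereDenseReduction X Y V)
    (hDC : ∀ U : Set C, IsClopen U → U.Nonempty → HasNowhereDenseReduction Y X U)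
    [Nonempty D] {U : Set C} {V : Set D} {R : Set (C × D)} (h : IsMatching X Y U V R)
    {K : Set C} (hK : IsClosed K) (hK' : interior K = ∅) {ε : ℝ} (hε : 0 < ε) :
    ∃ R' ⊆ R, IsMatching X Y U V R' ∧ (∀ x y y', (x, y) ∈ R' → (x, y') ∈ R' → dist y y' ≤ ε) ∧
      (∀ x x' y, (x, y) ∈ R' → (x', y) ∈ R' → dist x x' ≤ ε) ∧
      ∀ x ∈ K, ∀ y, (x, y) ∈ R' → IsExactAt X Y R' x y := by
  obtain ⟨R', hR', hm, hR'S⟩ := h.refine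
    (fun S => (∀ x y y', (x, y) ∈ S → (x, y') ∈ S → dist y y' ≤ ε) ∧
      (∀ x x' y, (x, y) ∈ S → (x', y) ∈ S → dist x x' ≤ ε) ∧
      ∀ x ∈ K, ∀ y, (x, y) ∈ S → IsExactAt X Y S x y) (by
    intro U V hU hV hUne hVne
    obtain ⟨g, hg, hinj, hgV, hg', hXY⟩ := hCD V hV hVne
    obtain ⟨k, hk, -, hkU, hk', -⟩ := hDC U hU hUne
    have hkc : IsClosed (range k) := (isCompact_range hk).isClosed
    obtain ⟨S, hS, h1, h2, h3⟩ := exists_isMatching_extending hU hV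
      (union_subset inter_subset_right hkU) ((hK.inter hU.isClosed).union hkc)
      (A := (K ∩ U) ∪ range k) (by
        rw [interior_union_isClosed_of_interior_empty (hK.inter hU.isClosed) hk']
        exact subset_empty_iff.1 ((interior_mono inter_subset_left).trans hK'.subset))
      ((range_nonempty k).inr) hg hinj hgV hg' hXY hε
    exact ⟨S, hS, h1, h2, fun x hx y hxy => h3 x (.inl ⟨hx, (hS.subset hxy).1⟩) y hxy⟩)
  refine ⟨R', hR', hm, fun x y y' hy hy' => ?_, fun x x' y hx hx' => ?_, fun x hx y hy => ?_⟩
  · rcases hR'S x y hy with hex | ⟨S, hS, hxy, h1, -⟩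
    · rw [hex.1 y' hy', dist_self]
      exact hε.le
    · exact hS.1 x y y' hxy (h1 y' hy')
  · rcases hR'S x y hx with hex | ⟨S, hS, hxy, -, h2⟩
    · rw [hex.2.1 x' hx', dist_self]
      exact hε.le
    · exact hS.2.1 x x' y hxy (h2 x' hx')
  · rcases hR'S x y hy with hex | ⟨S, hS, hxy, h1, h2⟩
    · exact hex
    · have hex := hS.2.2 x hx y hxy
      exact ⟨fun y' hy' => hex.1 y' (h1 y' hy'), fun x' hx' => hex.2.1 x' (h2 x' hx'), hex.2.2⟩

/-- Two subsets of zero-dimensional compacta which are covered by countably many closed nowhere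
dense sets and which mutually reduce to each other inside every clopen set are homeomorphic. -/
theorem nonempty_homeomorph_of_hasNowhereDenseReduction [Nonempty C] [Nonempty D]
    {K : ℕ → Set C} (hK : ∀ n, IsClosed (K n)) (hK' : ∀ n, interior (K n) = ∅)
    (hXK : X ⊆ ⋃ n, K n)
    {L : ℕ → Set D} (hL : ∀ n, IsClosed (L n)) (hL' : ∀ n, interior (L n) = ∅)
    (hYL : Y ⊆ ⋃ n, L n)
    (hCD : ∀ V : Set D, IsClopen V → V.Nonempty → HasNowhereDenseReduction X Y V)
    (hDC : ∀ U : Set C, IsClopen U → U.Nonempty → HasNowhereDenseReduction Y X U) :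
    Nonempty (X ≃ₜ Y) := by
  have step : ∀ (n : ℕ) (R : {R : Set (C × D) // IsMatching X Y univ univ R}),
      ∃ R' : {R : Set (C × D) // IsMatching X Y univ univ R}, R'.1 ⊆ R.1 ∧
        (∀ x y y', (x, y) ∈ R'.1 → (x, y') ∈ R'.1 → dist y y' ≤ 1 / ((n : ℝ) + 1)) ∧
        (∀ x x' y, (x, y) ∈ R'.1 → (x', y) ∈ R'.1 → dist x x' ≤ 1 / ((n : ℝ) + 1)) ∧
        (∀ x y, (x, y) ∈ R'.1 → x ∈ K n ∨ y ∈ L n → (x ∈ X ↔ y ∈ Y)) := by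
    rintro n ⟨R, hR⟩
    have hn : 0 < 1 / ((n : ℝ) + 1) := Nat.one_div_pos_of_nat
    obtain ⟨R₁, hR₁, hm₁, h1, h2, h3⟩ := hR.refine_left hCD hDC (hK n) (hK' n) hn
    obtain ⟨R₂, hR₂, hm₂, -, -, h4⟩ := hm₁.swap.refine_left hDC hCD (hL n) (hL' n) hn
    have hsub : Prod.swap ⁻¹' R₂ ⊆ R₁ := fun p hp => hR₂ hp
    refine ⟨⟨_, hm₂.swap⟩, hsub.trans hR₁, fun x y y' hy hy' => h1 x y y' (hsub hy) (hsub hy'),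
      fun x x' y hx hx' => h2 x x' y (hsub hx) (hsub hx'), fun x y hxy h => ?_⟩
    rcases h with h | h
    · exact (h3 x h y (hsub hxy)).2.2
    · exact (h4 y h x hxy).2.2.symm
  choose next hnext h1 h2 h3 using step
  have h0 : IsMatching X Y (univ : Set C) (univ : Set D) univ :=
    ⟨by simp, isClosed_univ, by simp, by simp, fun x y _ => .inr ⟨univ, univ,
      ⟨isClopen_univ, isClopen_univ, univ_nonempty, univ_nonempty, by simp⟩, by simp⟩⟩
  let R : ℕ → {R : Set (C × D) // IsMatching X Y univ univ R} := fun n =>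
    Nat.rec ⟨univ, h0⟩ next n
  have hRsucc : ∀ n, R (n + 1) = next n (R n) := fun n => rfl
  have hanti : ∀ n, (R (n + 1)).1 ⊆ (R n).1 := fun n => hnext n (R n)
  let S : Set (C × D) := ⋂ n, (R n).1
  have hSR : ∀ n, S ⊆ (next n (R n)).1 := fun n => iInter_subset (fun n => (R n).1) (n + 1)
  have hS : IsClosed S := isClosed_iInter fun n => (R n).2.isClosed
  have hex : ∀ T : Set (C × D), IsClosed T → (∀ n, ((R n).1 ∩ T).Nonempty) → (S ∩ T).Nonempty := by
    intro T hT hne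
    have := IsCompact.nonempty_iInter_of_sequence_nonempty_isCompact_isClosed
      (fun n => (R n).1 ∩ T) (fun n => inter_subset_inter_left T (hanti n)) hne
      ((R 0).2.isClosed.inter hT).isCompact fun n => (R n).2.isClosed.inter hT
    rwa [← iInter_inter] at this
  have hleft : ∀ x, ∃ y, (x, y) ∈ S := by
    intro x
    obtain ⟨⟨x', y⟩, hS, hx⟩ := hex (Prod.fst ⁻¹' {x}) (isClosed_singleton.preimage continuous_fst)
      fun n => by
        obtain ⟨y, hy⟩ := (R n).2.left x (mem_univ x)
        exact ⟨(x, y), hy, rfl⟩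
    obtain rfl : x' = x := hx
    exact ⟨y, hS⟩
  have hright : ∀ y, ∃ x, (x, y) ∈ S := by
    intro y
    obtain ⟨⟨x, y'⟩, hS, hy⟩ := hex (Prod.snd ⁻¹' {y}) (isClosed_singleton.preimage continuous_snd)
      fun n => by
        obtain ⟨x, hx⟩ := (R n).2.right y (mem_univ y)
        exact ⟨(x, y), hx, rfl⟩
    obtain rfl : y' = y := hy
    exact ⟨x, hS⟩
  have hzero : ∀ r : ℝ, (∀ n : ℕ, r ≤ 1 / ((n : ℝ) + 1)) → r ≤ 0 := fun r hr =>
    ge_of_tendsto' tendsto_one_div_add_atTop_nhds_zero_nat hr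
  have huniq : ∀ x y y', (x, y) ∈ S → (x, y') ∈ S → y = y' := fun x y y' hy hy' =>
    dist_le_zero.1 <| hzero _ fun n => h1 n (R n) x y y' (hSR n hy) (hSR n hy')
  have huniq' : ∀ x x' y, (x, y) ∈ S → (x', y) ∈ S → x = x' := fun x x' y hx hx' =>
    dist_le_zero.1 <| hzero _ fun n => h2 n (R n) x x' y (hSR n hx) (hSR n hx')
  choose φ hφ using hleft
  choose ψ hψ using hright
  have hφc : Continuous φ := by
    refine continuous_iff_isClosed.2 fun T hT => ?_
    have : φ ⁻¹' T = Prod.fst '' (S ∩ Prod.snd ⁻¹' T) := by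
      ext x
      refine ⟨fun hx => ⟨(x, φ x), ⟨hφ x, hx⟩, rfl⟩, ?_⟩
      rintro ⟨⟨x', y⟩, ⟨hxy, hy⟩, rfl⟩
      rw [mem_preimage, huniq _ _ _ (hφ x') hxy]
      exact hy
    rw [this]
    exact ((hS.inter (hT.preimage continuous_snd)).isCompact.image continuous_fst).isClosed
  let e : C ≃ D := ⟨φ, ψ, fun x => huniq' _ _ _ (hψ _) (hφ x), fun y => huniq _ _ _ (hφ _) (hψ y)⟩
  let E : C ≃ₜ D := hφc.homeoOfEquivCompactToT2 (f := e)
  refine ⟨E.subtype fun x => ⟨fun hx => ?_, fun hy => ?_⟩⟩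
  · obtain ⟨n, hn⟩ := mem_iUnion.1 (hXK hx)
    exact (h3 n (R n) x (φ x) (hSR n (hφ x)) (.inl hn)).1 hx
  · obtain ⟨n, hn⟩ := mem_iUnion.1 (hYL hy)
    exact (h3 n (R n) x (φ x) (hSR n (hφ x)) (.inr hn)).2 hy

end Uniqueness

section Cube

/-- The points of the cube `ℕ → ℕ → SignType` all of whose rows are finitely supported. -/
def rowFinite : Set (ℕ → ℕ → SignType) :=
  {z | ∀ n, (Function.support (z n)).Finite}

theorem tendsto_update_atTop {X : ℕ → Type*} [∀ n, TopologicalSpace (X n)] (z w : ∀ n, X n) :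
    Tendsto (fun k => Function.update z k (w k)) atTop (𝓝 z) := by
  refine tendsto_pi_nhds.2 fun n => tendsto_const_nhds.congr' ?_
  filter_upwards [eventually_gt_atTop n] with k hk
  rw [Function.update_of_ne hk.ne]

theorem dense_rowFinite : Dense rowFinite := by
  intro z
  refine mem_closure_of_tendsto (b := atTop)
    (f := fun N n m => if n < N ∧ m < N then z n m else 0) ?_ (Eventually.of_forall fun N n => ?_)
  · refine tendsto_pi_nhds.2 fun n => tendsto_pi_nhds.2 fun m => tendsto_const_nhds.congr' ?_
    filter_upwards [eventually_gt_atTop n, eventually_gt_atTop m] with N hn hm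
    simp [hn, hm]
  · refine (finite_Iio N).subset fun m hm => ?_
    by_contra h
    simp_all

/-- Points whose row of index `n` is supported in `[0, k)`. -/
def rowBounded (n k : ℕ) : Set (ℕ → ℕ → SignType) :=
  {z | ∀ m, k ≤ m → z n m = 0}

theorem isClosed_rowBounded (n k : ℕ) : IsClosed (rowBounded n k) := by
  simp only [rowBounded, ofPred_forall]
  exact isClosed_iInter fun m => isClosed_iInter fun _ =>
    isClosed_eq (by fun_prop) continuous_const

theorem rowBounded_mono (n : ℕ) : Monotone (rowBounded n) :=
  fun _ _ h _ hz m hm => hz m (h.trans hm)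

theorem interior_rowBounded (n k : ℕ) : interior (rowBounded n k) = ∅ := by
  refine eq_empty_of_forall_notMem fun z hz => ?_
  have h1 : Tendsto (fun j => Function.update z n (Function.update (z n) j 1)) atTop (𝓝 z) := by
    have := (tendsto_const_nhds (x := z)).update n
      (tendsto_update_atTop (z n) fun _ => (1 : SignType))
    rwa [Function.update_eq_self] at this
  obtain ⟨j, hj, hkj⟩ := ((h1.eventually (isOpen_interior.mem_nhds hz)).and
    (eventually_ge_atTop k)).exists
  simpa using interior_subset hj j hkj

theorem finite_support_iff_exists_bound {f : ℕ → SignType} :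
    (Function.support f).Finite ↔ ∃ k, ∀ m, k ≤ m → f m = 0 := by
  constructor
  · intro h
    obtain ⟨k, hk⟩ := h.bddAbove
    refine ⟨k + 1, fun m hm => ?_⟩
    by_contra hne
    exact absurd (hk hne) (by omega)
  · rintro ⟨k, hk⟩
    exact (finite_Iio k).subset fun m hm => not_le.1 fun h => hm (hk m h)

theorem rowFinite_eq : rowFinite = ⋂ n, ⋃ k, rowBounded n k := by
  ext z
  simp [rowFinite, rowBounded, finite_support_iff_exists_bound]

open Classical in
/-- The indicator functions of a sequence of sets, as a map to a power of `SignType`. -/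
noncomputable def indicators {E : Type*} (G : ℕ → Set E) (x : E) (m : ℕ) : SignType :=
  if x ∈ G m then 1 else 0

theorem support_indicators {E : Type*} (G : ℕ → Set E) (x : E) :
    Function.support (indicators G x) = {m | x ∈ G m} := by
  ext m
  simp [indicators]

theorem indicators_ne_neg_one {E : Type*} (G : ℕ → Set E) (x : E) (m : ℕ) :
    indicators G x m ≠ -1 := by
  unfold indicators
  split_ifs <;> decide

variable {E : Type*} [TopologicalSpace E]

theorem exists_clopen_partition_of_isOpen [CompactSpace E] [T2Space E]
    [TotallyDisconnectedSpace E] [SecondCountableTopology E] {O : Set E} (hO : IsOpen O) :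
    ∃ G : ℕ → Set E, (∀ n, IsClopen (G n)) ∧ Pairwise (Function.onFun Disjoint G) ∧
      ⋃ n, G n = O := by
  obtain ⟨S, hS, rfl⟩ := (loc_compact_Haus_tot_disc_of_zero_dim (H := E)).open_eq_sUnion hO
  obtain ⟨T, hTc, hTS, hT⟩ := TopologicalSpace.isOpen_sUnion_countable S fun s hs => (hS hs).isOpen
  obtain ⟨t, ht⟩ := (hTc.insert ∅).exists_eq_range (insert_nonempty ∅ T)
  have hclop : ∀ n, IsClopen (t n) := by
    intro n
    rcases ht.ge (mem_range_self n) with h | h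
    · exact h ▸ isClopen_empty
    · exact hS (hTS h)
  refine ⟨disjointed t, fun n => disjointedRec (p := IsClopen) (fun _ _ h => h.diff (hclop _))
    (hclop n), disjoint_disjointed t, ?_⟩
  rw [iUnion_disjointed, ← sUnion_range, ← ht, sUnion_insert, empty_union, hT]

theorem continuous_indicators {G : ℕ → Set E} (hG : ∀ m, IsClopen (G m)) :
    Continuous (indicators G) := by
  classical
  refine continuous_pi fun m => ?_
  unfold indicators
  exact continuous_const.if (by simp [(hG m).frontier_eq]) continuous_const

variable [CompactSpace E] [T2Space E] [TotallyDisconnectedSpace E] [SecondCountableTopology E]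

theorem exists_continuous_finite_support_iff {F : ℕ → Set E} (hF : ∀ k, IsClosed (F k))
    (hmono : Monotone F) : ∃ f : E → ℕ → SignType, Continuous f ∧
      ∀ x, x ∈ ⋃ k, F k ↔ (Function.support (f x)).Finite := by
  choose G hG hGd hGU using fun k => exists_clopen_partition_of_isOpen (hF k).isOpen_compl
  refine ⟨indicators fun m => G m.unpair.1 m.unpair.2,
    continuous_indicators fun m => hG _ _, fun x => ?_⟩
  rw [support_indicators]
  constructor
  · intro hx
    obtain ⟨N, hN⟩ := mem_iUnion.1 hx
    have hfin : (⋃ k ∈ Iio N, Nat.pair k '' {j | x ∈ G k j}).Finite := by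
      refine (finite_Iio N).biUnion fun k _ => Finite.image _ (Set.Subsingleton.finite ?_)
      intro i hi j hj
      by_contra hij
      exact disjoint_left.1 (hGd k hij) hi hj
    refine hfin.subset fun m (hm : x ∈ G m.unpair.1 m.unpair.2) => ?_
    refine mem_biUnion (x := m.unpair.1) (mem_Iio.2 (not_le.1 fun hle => ?_))
      ⟨m.unpair.2, hm, m.pair_unpair⟩
    exact (hGU m.unpair.1).subset (mem_iUnion.2 ⟨_, hm⟩) (hmono hle hN)
  · intro hfin
    by_contra hx
    rw [mem_iUnion, not_exists] at hx
    choose j hj using fun k => mem_iUnion.1 ((hGU k).superset (hx k))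
    refine (infinite_range_of_injective (f := fun k => Nat.pair k (j k)) fun k l h => ?_)
      (hfin.subset ?_)
    · exact (Nat.pair_eq_pair.1 h).1
    · rintro _ ⟨k, rfl⟩
      simpa using hj k

theorem exists_continuous_injective_ne_neg_one :
    ∃ d : E → ℕ → SignType, Continuous d ∧ Function.Injective d ∧ ∀ x m, d x m ≠ -1 := by
  obtain ⟨b, hbc, hb0, hb⟩ := TopologicalSpace.exists_countable_basis E
  obtain ⟨t, ht⟩ := (hbc.insert ∅).exists_eq_range (insert_nonempty ∅ b)
  have ho : ∀ n, IsOpen (t n) := by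
    intro n
    rcases ht.ge (mem_range_self n) with h | h
    · exact h ▸ isOpen_empty
    · exact hb.isOpen h
  choose G hG hGd hGU using fun n => exists_clopen_partition_of_isOpen (ho n)
  refine ⟨indicators fun m => G m.unpair.1 m.unpair.2, continuous_indicators fun m => hG _ _,
    fun x y hxy => ?_, indicators_ne_neg_one _⟩
  by_contra hne
  obtain ⟨v, hv, hxv, hvy⟩ := hb.mem_nhds_iff.1 (isOpen_ne.mem_nhds hne)
  obtain ⟨n, rfl⟩ := ht.subset (mem_insert_of_mem _ hv)
  obtain ⟨j, hj⟩ := mem_iUnion.1 ((hGU n).superset hxv)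
  have h1 := congrArg Function.support hxy
  rw [support_indicators, support_indicators] at h1
  have h2 : Nat.pair n j ∈ {m : ℕ | y ∈ G m.unpair.1 m.unpair.2} := h1 ▸ by simpa using hj
  have h3 : y ∈ G n j := by simpa using h2
  exact hvy ((hGU n).subset (mem_iUnion.2 ⟨j, h3⟩)) rfl

/-- `rowFinite` is universal for `F_σδ` sets. -/
theorem hasNowhereDenseReduction_rowFinite {F : ℕ → ℕ → Set E} (hF : ∀ n k, IsClosed (F n k))
    (hmono : ∀ n, Monotone (F n)) {U : Set (ℕ → ℕ → SignType)} (hU : IsOpen U)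
    (hne : U.Nonempty) : HasNowhereDenseReduction (⋂ n, ⋃ k, F n k) rowFinite U := by
  obtain ⟨u, hu⟩ := hne
  choose f hf hfF using fun n => exists_continuous_finite_support_iff (hF n) (hmono n)
  obtain ⟨d, hd, hdi, hd1⟩ := exists_continuous_injective_ne_neg_one (E := E)
  let g : ℕ → E → ℕ → ℕ → SignType := fun N x n m =>
    if n < N then if m < N then u n m else 0
    else if m = 0 then d x (n - N) else f (n - N) x (m - 1)
  have hlim : Tendsto (fun p : ℕ × E => g p.1 p.2) (atTop ×ˢ 𝓟 univ) (𝓝 u) := by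
    refine tendsto_pi_nhds.2 fun n => tendsto_pi_nhds.2 fun m => tendsto_const_nhds.congr' ?_
    refine eventually_prod_principal_iff.2 ?_
    filter_upwards [eventually_gt_atTop n, eventually_gt_atTop m] with N hn hm x _
    simp [g, hn, hm]
  obtain ⟨N, hN⟩ := (eventually_prod_principal_iff.1 (hlim.eventually (hU.mem_nhds hu))).exists
  have hzero : ∀ x k, g N x (N + k) 0 = d x k := by simp [g]
  have hsucc : ∀ x k m, g N x (N + k) (m + 1) = f k x m := by simp [g]
  refine ⟨g N, ?_, ?_, ?_, ?_, ?_⟩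
  · refine continuous_pi fun n => continuous_pi fun m => ?_
    simp only [g]
    split_ifs
    · exact continuous_const
    · exact continuous_const
    · exact (continuous_apply _).comp hd
    · exact (continuous_apply _).comp (hf _)
  · intro x y hxy
    refine hdi (funext fun k => ?_)
    rw [← hzero, hxy, hzero]
  · rintro _ ⟨x, rfl⟩
    exact hN x (mem_univ x)
  · refine eq_empty_of_forall_notMem fun w hw => ?_
    obtain ⟨k, hk, hNk⟩ := (((tendsto_update_atTop w fun _ _ => -1).eventually
      (isOpen_interior.mem_nhds hw)).and (eventually_ge_atTop N)).exists
    obtain ⟨x, hx⟩ := interior_subset hk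
    obtain ⟨j, rfl⟩ := Nat.exists_eq_add_of_le hNk
    have := congrFun (congrFun hx (N + j)) 0
    rw [hzero, Function.update_self] at this
    exact hd1 _ _ this
  · intro x
    have hrow : ∀ k, (Function.support (g N x (N + k))).Finite ↔
        (Function.support (f k x)).Finite := by
      intro k
      constructor
      · intro h
        refine (h.preimage (Nat.succ_injective.injOn)).subset fun m hm => ?_
        rw [mem_preimage, Function.mem_support, Nat.succ_eq_add_one, hsucc]
        exact hm
      · intro h
        refine ((h.image Nat.succ).insert 0).subset fun m hm => ?_
        rcases m with _ | m
        · exact mem_insert _ _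
        · refine mem_insert_of_mem _ ⟨m, ?_, rfl⟩
          rwa [Function.mem_support, hsucc] at hm
    rw [mem_iInter]
    refine ⟨fun h n => ?_, fun h n => (hfF n x).2 ((hrow n).1 (h _))⟩
    rcases lt_or_ge n N with hn | hn
    · refine (finite_Iio N).subset fun m hm => ?_
      by_contra hmN
      simp_all [g]
    · obtain ⟨k, rfl⟩ := Nat.exists_eq_add_of_le hn
      exact (hrow k).2 ((hfF k x).1 (h k))

end Cube

section Hyperspace

open TopologicalSpace

theorem exists_subset_of_finite_of_monotone {α : Type*} {s : Set α} (hs : s.Finite)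
    {F : ℕ → Set α} (hF : Monotone F) (h : s ⊆ ⋃ k, F k) : ∃ k, s ⊆ F k := by
  have h' : ∀ x ∈ s, ∃ k, x ∈ F k := fun x hx => mem_iUnion.1 (h hx)
  choose! k hk using h'
  obtain ⟨N, hN⟩ := (hs.image k).bddAbove
  exact ⟨N, fun x hx => hF (hN (mem_image_of_mem k hx)) (hk x hx)⟩

variable {α : Type*} [TopologicalSpace α]

theorem totallyDisconnectedSpace_nonemptyCompacts [CompactSpace α] [T2Space α]
    [TotallyDisconnectedSpace α] : TotallyDisconnectedSpace (NonemptyCompacts α) := by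
  have key : ∀ (K L : NonemptyCompacts α), ∀ z ∈ K, z ∉ L →
      ∃ S : Set (NonemptyCompacts α), IsClopen S ∧ K ∈ S ∧ L ∈ Sᶜ := by
    intro K L z hK hL
    obtain ⟨O, hO, hzO, hOL⟩ := compact_exists_isClopen_in_isOpen
      (L.isCompact.isClosed.isOpen_compl) (show z ∈ (L : Set α)ᶜ from hL)
    exact ⟨{M | ((M : Set α) ∩ O).Nonempty},
      ⟨NonemptyCompacts.isClosed_inter_nonempty_of_isClosed hO.isClosed,
        NonemptyCompacts.isOpen_inter_nonempty_of_isOpen hO.isOpen⟩,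
      ⟨z, hK, hzO⟩, fun ⟨w, hw, hwO⟩ => hOL hwO hw⟩
  have : TotallySeparatedSpace (NonemptyCompacts α) := by
    refine totallySeparatedSpace_iff_exists_isClopen.2 fun K L hne => ?_
    by_cases hKL : (K : Set α) ⊆ L
    · obtain ⟨z, hz, hzK⟩ := not_subset.1 fun h => hne (SetLike.coe_injective (hKL.antisymm h))
      obtain ⟨S, hS, hL, hK⟩ := key L K z hz hzK
      exact ⟨Sᶜ, hS.compl, hK, by simpa using hL⟩
    · obtain ⟨z, hz, hzL⟩ := not_subset.1 hKL
      exact key K L z hz hzL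
  infer_instance

theorem continuous_sup_singleton (K : NonemptyCompacts α) :
    Continuous fun w : α => K ⊔ {w} :=
  continuous_const.sup NonemptyCompacts.continuous_singleton

theorem sup_singleton_eq_self {K : NonemptyCompacts α} {z : α} (hz : z ∈ K) : K ⊔ {z} = K :=
  SetLike.coe_injective (by simpa using hz)

theorem interior_setOf_subset_nonemptyCompacts {F : Set α} (hF : interior F = ∅) :
    interior {K : NonemptyCompacts α | (K : Set α) ⊆ F} = ∅ := by
  refine eq_empty_of_forall_notMem fun K hK => ?_
  obtain ⟨z, hz⟩ := K.nonempty
  have hz' : z ∈ (fun w : α => K ⊔ {w}) ⁻¹'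
      interior {K : NonemptyCompacts α | (K : Set α) ⊆ F} := by
    rwa [mem_preimage, sup_singleton_eq_self hz]
  have : z ∈ interior F := mem_interior.2 ⟨_, fun w hw => ?_,
    isOpen_interior.preimage (continuous_sup_singleton K), hz'⟩
  · exact (hF ▸ this : z ∈ (∅ : Set α))
  · exact interior_subset hw (by simp)

theorem isClosed_setOf_encard_le [T2Space α] (k : ℕ) :
    IsClosed {K : NonemptyCompacts α | (K : Set α).encard ≤ k} := by
  rw [← isOpen_compl_iff, isOpen_iff_mem_nhds]
  intro K hK
  rw [mem_compl_iff, mem_ofPred_eq, not_le] at hK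
  obtain ⟨t, htK, ht⟩ := exists_subset_encard_eq (Order.add_one_le_of_lt hK)
  have htf : t.Finite := by
    rw [← encard_ne_top_iff, ht]
    exact WithTop.coe_ne_top
  obtain ⟨U, hU, hd⟩ := htf.t2_separation
  have hmem : ⋂ x ∈ t, {L : NonemptyCompacts α | ((L : Set α) ∩ U x).Nonempty} ∈ 𝓝 K :=
    (htf.isOpen_biInter fun x _ =>
      NonemptyCompacts.isOpen_inter_nonempty_of_isOpen (hU x).2).mem_nhds
      (mem_iInter₂.2 fun x hx => ⟨x, htK hx, (hU x).1⟩)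
  filter_upwards [hmem] with L hL
  rw [mem_compl_iff, mem_ofPred_eq, not_le]
  choose! f hf using fun x hx => mem_iInter₂.1 hL x hx
  have hinj : InjOn f t := by
    intro x hx y hy hxy
    by_contra hne
    exact disjoint_left.1 (hd hx hy hne) (hf x hx).2 (hxy ▸ (hf y hy).2)
  have := encard_le_encard_of_injOn (fun x hx => (hf x hx).1) hinj
  rw [ht] at this
  exact (ENat.add_one_le_iff (ENat.natCast_ne_top k)).1 this

/-- The finite nonempty subsets of the cube that consist of points of `rowFinite`. -/
def finiteRowFinite : Set (NonemptyCompacts (ℕ → ℕ → SignType)) :=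
  {K | (K : Set (ℕ → ℕ → SignType)).Finite ∧ (K : Set (ℕ → ℕ → SignType)) ⊆ rowFinite}

theorem finiteRowFinite_eq : finiteRowFinite = ⋂ n, ⋃ k : ℕ,
    {K : NonemptyCompacts (ℕ → ℕ → SignType) | (K : Set (ℕ → ℕ → SignType)).encard ≤ k} ∩
      {K | (K : Set (ℕ → ℕ → SignType)) ⊆ rowBounded n k} := by
  ext K
  simp only [mem_iInter, mem_iUnion]
  constructor
  · rintro ⟨hfin, hK⟩ n
    obtain ⟨k, hk⟩ := exists_subset_of_finite_of_monotone hfin (rowBounded_mono n)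
      (hK.trans (rowFinite_eq.subset.trans (iInter_subset _ n)))
    obtain ⟨c, hc⟩ := ENat.ne_top_iff_exists.1 hfin.encard_lt_top.ne
    refine ⟨max c k, ?_, hk.trans (rowBounded_mono n (le_max_right _ _))⟩
    rw [mem_ofPred_eq, ← hc]
    exact_mod_cast le_max_left c k
  · intro h
    refine ⟨?_, fun z hz => ?_⟩
    · obtain ⟨k, hk, -⟩ := h 0
      exact finite_of_encard_le_coe hk
    · rw [rowFinite_eq]
      refine mem_iInter.2 fun n => ?_
      obtain ⟨k, -, hk⟩ := h n
      exact mem_iUnion.2 ⟨k, hk hz⟩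

theorem hasNowhereDenseReduction_finiteRowFinite_rowFinite {U : Set (ℕ → ℕ → SignType)}
    (hU : IsOpen U) (hne : U.Nonempty) :
    HasNowhereDenseReduction finiteRowFinite rowFinite U := by
  have := totallyDisconnectedSpace_nonemptyCompacts (α := ℕ → ℕ → SignType)
  rw [finiteRowFinite_eq]
  refine hasNowhereDenseReduction_rowFinite (fun n k => ?_) (fun n k l hkl K hK => ?_) hU hne
  · exact (isClosed_setOf_encard_le k).inter
      (NonemptyCompacts.isClosed_subsets_of_isClosed (isClosed_rowBounded n k))
  · have h : (K : Set (ℕ → ℕ → SignType)).encard ≤ k := hK.1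
    exact ⟨h.trans (Nat.cast_le.2 hkl), hK.2.trans (rowBounded_mono n hkl)⟩

theorem hasNowhereDenseReduction_rowFinite_finiteRowFinite
    {V : Set (NonemptyCompacts (ℕ → ℕ → SignType))} (hV : IsOpen V) (hne : V.Nonempty) :
    HasNowhereDenseReduction rowFinite finiteRowFinite V := by
  obtain ⟨P, hPV, hP⟩ : (V ∩ finiteRowFinite).Nonempty := by
    refine Dense.inter_open_nonempty (fun K => ?_) V hV hne
    rw [finiteRowFinite, NonemptyCompacts.closure_finite_subsets, dense_rowFinite.closure_eq]
    exact subset_univ _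
  obtain ⟨p, hp⟩ := P.nonempty
  have hPi : interior (P : Set (ℕ → ℕ → SignType)) = ∅ := by
    obtain ⟨k, hk⟩ := exists_subset_of_finite_of_monotone hP.1 (rowBounded_mono 0)
      (hP.2.trans (rowFinite_eq.subset.trans (iInter_subset _ 0)))
    exact subset_empty_iff.1 ((interior_mono hk).trans (interior_rowBounded 0 k).subset)
  have hO : IsOpen ((fun w => P ⊔ {w}) ⁻¹' V) := hV.preimage (continuous_sup_singleton P)
  obtain ⟨g, hg, hgi, hgV, hgn, hgX⟩ : HasNowhereDenseReduction rowFinite rowFinite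
      (((fun w => P ⊔ {w}) ⁻¹' V) \ P) := by
    conv => arg 1; rw [rowFinite_eq]
    refine hasNowhereDenseReduction_rowFinite isClosed_rowBounded rowBounded_mono
      (hO.sdiff P.isCompact.isClosed) (nonempty_iff_ne_empty.2 fun h => ?_)
    have : p ∈ interior (P : Set (ℕ → ℕ → SignType)) :=
      interior_maximal (sdiff_eq_empty.1 h) hO
        (by rwa [mem_preimage, sup_singleton_eq_self hp])
    exact (hPi ▸ this : p ∈ (∅ : Set (ℕ → ℕ → SignType)))
  have hcoe : ∀ x, ((P ⊔ {g x} : NonemptyCompacts (ℕ → ℕ → SignType)) :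
      Set (ℕ → ℕ → SignType)) = ↑P ∪ {g x} := fun x => by simp
  refine ⟨fun x => P ⊔ {g x}, (continuous_sup_singleton P).comp hg, fun x y hxy => ?_, ?_, ?_, ?_⟩
  · have h1 : g x ∈ (P : Set (ℕ → ℕ → SignType)) ∪ {g y} := by
      rw [← hcoe y, ← show P ⊔ {g x} = P ⊔ {g y} from hxy, hcoe x]
      exact .inr rfl
    exact hgi (h1.resolve_left (hgV (mem_range_self x)).2)
  · rintro _ ⟨x, rfl⟩
    exact (hgV (mem_range_self x)).1
  · have hi : interior (range g ∪ P) = ∅ := by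
      rw [interior_union_isClosed_of_interior_empty (isCompact_range hg).isClosed hPi, hgn]
    refine subset_empty_iff.1 (Subset.trans (interior_mono ?_)
      (interior_setOf_subset_nonemptyCompacts hi).subset)
    rintro _ ⟨x, rfl⟩
    rw [mem_ofPred_eq, hcoe]
    exact union_subset subset_union_right (singleton_subset_iff.2 (.inl (mem_range_self x)))
  · intro x
    rw [finiteRowFinite, mem_ofPred_eq, hcoe, union_subset_iff, singleton_subset_iff, hgX]
    exact ⟨fun h => ⟨hP.1.union (finite_singleton _), hP.2, h⟩, fun h => h.2.2⟩

theorem nonempty_homeomorph_rowFinite_finiteRowFinite :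
    Nonempty (rowFinite ≃ₜ finiteRowFinite) := by
  have := totallyDisconnectedSpace_nonemptyCompacts (α := ℕ → ℕ → SignType)
  let _ := metrizableSpaceMetric (ℕ → ℕ → SignType)
  let _ := metrizableSpaceMetric (NonemptyCompacts (ℕ → ℕ → SignType))
  refine nonempty_homeomorph_of_hasNowhereDenseReduction (isClosed_rowBounded 0)
    (interior_rowBounded 0) (rowFinite_eq.subset.trans (iInter_subset _ 0))
    (fun k => NonemptyCompacts.isClosed_subsets_of_isClosed (isClosed_rowBounded 0 k))
    (fun k => interior_setOf_subset_nonemptyCompacts (interior_rowBounded 0 k)) ?_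
    (fun V hV hne => hasNowhereDenseReduction_rowFinite_finiteRowFinite hV.isOpen hne)
    (fun U hU hne => hasNowhereDenseReduction_finiteRowFinite_rowFinite hU.isOpen hne)
  intro K hK
  exact mem_iUnion.2 (exists_subset_of_finite_of_monotone hK.1 (rowBounded_mono 0)
    (hK.2.trans (rowFinite_eq.subset.trans (iInter_subset _ 0))))

end Hyperspace

section FinHyp

variable {A B : Type*} [TopologicalSpace B]

/-- The image of a nonempty finite set under a map, as a nonempty compact set. -/
def FinHyp.image (f : A → B) (F : FinHyp A) : TopologicalSpace.NonemptyCompacts B :=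
  ⟨⟨f '' F.1, (F.2.1.image f).isCompact⟩, F.2.2.image f⟩

theorem FinHyp.range_image {f : A → B} (hf : Function.Injective f) :
    range (FinHyp.image f) =
      {K : TopologicalSpace.NonemptyCompacts B | (K : Set B).Finite ∧ (K : Set B) ⊆ range f} := by
  ext K
  constructor
  · rintro ⟨F, rfl⟩
    exact ⟨F.2.1.image f, image_subset_range f F.1⟩
  · rintro ⟨hK, hKf⟩
    have heq : f '' (f ⁻¹' K) = K := image_preimage_eq_of_subset hKf
    exact ⟨⟨f ⁻¹' K, hK.preimage hf.injOn, image_nonempty.1 (heq.symm ▸ K.nonempty)⟩,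
      SetLike.coe_injective heq⟩

variable [TopologicalSpace A]

theorem vietoris_eq : vietoris ‹TopologicalSpace A› = TopologicalSpace.vietoris A := by
  unfold vietoris TopologicalSpace.vietoris
  congr 1
  ext S
  refine or_congr (exists_congr fun U => and_congr_right fun _ => eq_comm)
    (exists_congr fun U => and_congr_right fun _ => eq_comm)

theorem FinHyp.isEmbedding_image {f : A → B} (hf : IsEmbedding f) :
    IsEmbedding (FinHyp.image f) := by
  let _ := TopologicalSpace.vietoris A
  let _ := TopologicalSpace.vietoris B
  have hval : @IsEmbedding (FinHyp A) (Set A) _ _ Subtype.val :=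
    ⟨⟨congrArg (TopologicalSpace.induced Subtype.val) vietoris_eq⟩, Subtype.val_injective⟩
  exact TopologicalSpace.NonemptyCompacts.isEmbedding_coe.of_comp_iff.1
    (hf.image_vietoris.comp hval)

end FinHyp

section Rat

theorem toLex_lt_toLex_iff {x y : ℕ →₀ SignType} :
    toLex x < toLex y ↔ ∃ i, (∀ j < i, x j = y j) ∧ x i < y i :=
  Finsupp.lex_def

theorem exists_forall_ge_eq_zero (x : ℕ →₀ SignType) (N : ℕ) :
    ∃ k, N ≤ k ∧ ∀ m, k ≤ m → x m = 0 := by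
  obtain ⟨k, hk⟩ := finite_support_iff_exists_bound.1 x.hasFiniteSupport
  exact ⟨max N k, le_max_left _ _, fun m hm => hk m ((le_max_right _ _).trans hm)⟩

theorem update_apply_self (x : ℕ →₀ SignType) (k : ℕ) (s : SignType) : x.update k s k = s := by
  classical
  rw [Finsupp.coe_update, Function.update_self]

theorem update_apply_of_ne (x : ℕ →₀ SignType) {k j : ℕ} (s : SignType) (h : j ≠ k) :
    x.update k s j = x j := by
  classical
  rw [Finsupp.coe_update, Function.update_of_ne h]

theorem toLex_lt_update_one {x : ℕ →₀ SignType} {k : ℕ} (hk : x k = 0) :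
    toLex x < toLex (x.update k 1) :=
  toLex_lt_toLex_iff.2 ⟨k, fun j hj => (update_apply_of_ne x 1 hj.ne).symm, by
    rw [update_apply_self, hk]; decide⟩

theorem update_neg_one_lt_toLex {x : ℕ →₀ SignType} {k : ℕ} (hk : x k = 0) :
    toLex (x.update k (-1)) < toLex x :=
  toLex_lt_toLex_iff.2 ⟨k, fun j hj => update_apply_of_ne x (-1) hj.ne, by
    rw [update_apply_self, hk]; decide⟩

theorem eq_of_update_lt_of_lt_update {x y : ℕ →₀ SignType} {k : ℕ} {s t : SignType}
    (h1 : toLex (x.update k s) < toLex y) (h2 : toLex y < toLex (x.update k t)) :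
    ∀ i < k, y i = x i := by
  intro i
  induction i using Nat.strong_induction_on with
  | _ i ih =>
    intro hi
    have heq : ∀ s, ∀ j < i, y j = x.update k s j := fun s j hj =>
      (ih j hj (hj.trans hi)).trans (update_apply_of_ne x s (hj.trans hi).ne).symm
    rcases lt_trichotomy (y i) (x i) with h | h | h
    · refine absurd (toLex_lt_toLex_iff.2 ⟨i, heq s, ?_⟩) h1.not_gt
      rwa [update_apply_of_ne x s hi.ne]
    · exact h
    · refine absurd (toLex_lt_toLex_iff.2 ⟨i, fun j hj => (heq t j hj).symm, ?_⟩) h2.not_gt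
      rwa [update_apply_of_ne x t hi.ne]

theorem exists_forall_toLex_lt {x y : ℕ →₀ SignType} (h : toLex x < toLex y) :
    ∃ k : ℕ, ∀ z : ℕ →₀ SignType, ((∀ i < k, z i = x i) → toLex z < toLex y) ∧
      ((∀ i < k, z i = y i) → toLex x < toLex z) := by
  obtain ⟨i, hi, hlt⟩ := toLex_lt_toLex_iff.1 h
  refine ⟨i + 1, fun z => ⟨fun hz => toLex_lt_toLex_iff.2 ⟨i, fun j hj => ?_, ?_⟩,
    fun hz => toLex_lt_toLex_iff.2 ⟨i, fun j hj => ?_, ?_⟩⟩⟩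
  · rw [hz j (hj.trans i.lt_succ_self), hi j hj]
  · rwa [hz i i.lt_succ_self]
  · rw [hz j (hj.trans i.lt_succ_self), hi j hj]
  · rwa [hz i i.lt_succ_self]

theorem nonempty_rat_orderIso_lex : Nonempty (ℚ ≃o Lex (ℕ →₀ SignType)) := by
  have : NoMaxOrder (Lex (ℕ →₀ SignType)) := ⟨fun x => by
    obtain ⟨k, -, hk⟩ := exists_forall_ge_eq_zero (ofLex x) 0
    exact ⟨_, toLex_lt_update_one (hk k le_rfl)⟩⟩
  have : NoMinOrder (Lex (ℕ →₀ SignType)) := ⟨fun x => by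
    obtain ⟨k, -, hk⟩ := exists_forall_ge_eq_zero (ofLex x) 0
    exact ⟨_, update_neg_one_lt_toLex (hk k le_rfl)⟩⟩
  have : DenselyOrdered (Lex (ℕ →₀ SignType)) := ⟨fun x y hxy => by
    obtain ⟨N, hN⟩ := exists_forall_toLex_lt hxy
    obtain ⟨k, hNk, hk⟩ := exists_forall_ge_eq_zero (ofLex x) N
    exact ⟨toLex ((ofLex x).update k 1), toLex_lt_update_one (hk k le_rfl),
      (hN _).1 fun i hi => update_apply_of_ne _ 1 (hi.trans_le hNk).ne⟩⟩
  have : Countable (Lex (ℕ →₀ SignType)) :=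
    inferInstanceAs (Countable (ℕ →₀ SignType))
  have : Nonempty (Lex (ℕ →₀ SignType)) := ⟨toLex 0⟩
  exact Order.iso_of_countable_dense ℚ _

theorem exists_isEmbedding_rat : ∃ g : ℚ → ℕ → SignType, IsEmbedding g ∧
    range g = {w | (Function.support w).Finite} := by
  obtain ⟨e⟩ := nonempty_rat_orderIso_lex
  refine ⟨fun q => ⇑(ofLex (e q)), ⟨isInducing_iff_nhds.2 fun q => le_antisymm ?_ ?_, ?_⟩, ?_⟩
  · refine tendsto_iff_comap.1 (tendsto_pi_nhds.2 fun i => ?_)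
    rw [nhds_discrete SignType, tendsto_pure]
    obtain ⟨k, hik, hk⟩ := exists_forall_ge_eq_zero (ofLex (e q)) (i + 1)
    filter_upwards [Ioo_mem_nhds
      (e.symm_apply_lt.2 (update_neg_one_lt_toLex (hk k le_rfl)))
      (e.lt_symm_apply.2 (toLex_lt_update_one (hk k le_rfl)))] with p hp
    exact eq_of_update_lt_of_lt_update (e.symm_apply_lt.1 hp.1) (e.lt_symm_apply.1 hp.2)
      i hik
  · refine (nhds_basis_Ioo q).ge_iff.2 fun ⟨a, b⟩ ⟨ha, hb⟩ => ?_
    obtain ⟨k, hk⟩ := exists_forall_toLex_lt (e.lt_iff_lt.2 ha)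
    obtain ⟨l, hl⟩ := exists_forall_toLex_lt (e.lt_iff_lt.2 hb)
    have hmem : {w : ℕ → SignType | ∀ i < max k l, w i = ofLex (e q) i} ∈
        𝓝 (⇑(ofLex (e q))) := by
      refine ((finite_Iio (max k l)).eventually_all (l := 𝓝 (⇑(ofLex (e q))))).2 fun i _ => ?_
      exact ((isOpen_discrete {ofLex (e q) i}).preimage
        (continuous_apply (A := fun _ => SignType) i)).mem_nhds rfl
    refine ⟨_, hmem, fun p hp => ⟨e.lt_iff_lt.1 ((hk _).2 fun i hi => ?_),
      e.lt_iff_lt.1 ((hl _).1 fun i hi => ?_)⟩⟩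
    · exact hp i (hi.trans_le (le_max_left _ _))
    · exact hp i (hi.trans_le (le_max_right _ _))
  · exact fun p q h => e.injective (ofLex.injective (DFunLike.coe_injective h))
  · ext w
    constructor
    · rintro ⟨q, rfl⟩
      exact (ofLex (e q)).hasFiniteSupport
    · intro hw
      refine ⟨e.symm (toLex (Finsupp.ofSupportFinite w hw)), ?_⟩
      simp only [OrderIso.apply_symm_apply, ofLex_toLex]
      rfl

theorem exists_isEmbedding_nat_rat : ∃ g : (ℕ → ℚ) → ℕ → ℕ → SignType, IsEmbedding g ∧
    range g = rowFinite := by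
  obtain ⟨g, hg, hgr⟩ := exists_isEmbedding_rat
  refine ⟨Pi.map fun _ => g, IsEmbedding.piMap fun _ => hg, ?_⟩
  rw [Set.range_piMap]
  ext z
  simp [rowFinite, hgr]

end Rat

/-- The Vietoris hyperspace `ℱ(ℚ^ω)` of nonempty finite subsets of `ℚ^ω` is
homeomorphic to `ℚ^ω`. -/
theorem finHyp_rationalPower_homeomorph :
    Nonempty (FinHyp (ℕ → ℚ) ≃ₜ (ℕ → ℚ)) := by
  obtain ⟨g, hg, hgr⟩ := exists_isEmbedding_nat_rat
  obtain ⟨h⟩ := nonempty_homeomorph_rowFinite_finiteRowFinite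
  have hr : range (FinHyp.image g) = finiteRowFinite := by
    rw [FinHyp.range_image hg.injective, hgr]
    rfl
  exact ⟨(FinHyp.isEmbedding_image hg).toHomeomorph.trans <| (Homeomorph.setCongr hr).trans <|
    h.symm.trans <| (Homeomorph.setCongr hgr.symm).trans hg.toHomeomorph.symm⟩
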